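/- Let X ∈ ℝ^{n×d₀}, Y ∈ ℝ^{n×d₂}, and define R(W₁,W₂) = (1/2n)‖Yᵀ − W₂W₁Xᵀ‖_F² for W₁ ∈ ℝ^{d₁×d₀}, W₂ ∈ ℝ^{d₂×d₁}. Let E₁ ∈ ℝ^{d₁×d₀}, E₂ ∈ ℝ^{d₂×d₁} be independent random matrices with i.i.d. standard Gaussian entries. Then the fully perturbed risk satisfies exactly: E[R(W₁ + σE₁, W₂ + σE₂)] = R(W₁,W₂) + (σ²/2n)[‖W₂‖_F²‖X‖_F² + d₂‖W₁Xᵀ‖_F²] + (σ⁴/2n) d₁d₂‖X‖_F². In particular the fully perturbed risk contains an additional variance term (σ⁴/2n)d₁d₂‖X‖_F² that diverges as the hidden width d₁ → ∞. -/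

import Mathlib

open Matrix MeasureTheory ProbabilityTheory Filter

/-- Squared Frobenius norm of a matrix. -/
def frobSq {a b : ℕ} (A : Matrix (Fin a) (Fin b) ℝ) : ℝ := ∑ i, ∑ j, (A i j) ^ 2

/-- The law of an `a × b` random matrix with i.i.d. standard Gaussian entries. -/
noncomputable def gaussMatrix (a b : ℕ) : Measure (Fin a → Fin b → ℝ) :=
  Measure.pi fun _ : Fin a => Measure.pi fun _ : Fin b => gaussianReal 0 1

/-- The square-loss risk `R(W₁,W₂) = (1/2n)‖Yᵀ - W₂W₁Xᵀ‖_F²` of the two-layer linear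
network. -/
noncomputable def risk (n d₀ d₁ d₂ : ℕ) (X : Matrix (Fin n) (Fin d₀) ℝ)
    (Y : Matrix (Fin n) (Fin d₂) ℝ)
    (W₁ : Matrix (Fin d₁) (Fin d₀) ℝ) (W₂ : Matrix (Fin d₂) (Fin d₁) ℝ) : ℝ :=
  (1 / (2 * (n : ℝ))) * frobSq (Yᵀ - W₂ * W₁ * Xᵀ)

instance gaussMatrix_isProb (a b : ℕ) : IsProbabilityMeasure (gaussMatrix a b) := by
  unfold gaussMatrix; infer_instance

lemma gm_entry_mp {a b : ℕ} (k : Fin a) (l : Fin b) :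
    MeasurePreserving (fun E : Fin a → Fin b → ℝ => E k l) (gaussMatrix a b) (gaussianReal 0 1) := by
  have h1 := measurePreserving_eval
    (fun _ : Fin a => Measure.pi fun _ : Fin b => gaussianReal 0 1) k
  have h2 := measurePreserving_eval (fun _ : Fin b => gaussianReal 0 1) l
  exact h2.comp h1

lemma gm_entry_memLp {a b : ℕ} (k : Fin a) (l : Fin b) (p : ENNReal) (hp : p ≠ ⊤) :
    MemLp (fun E : Fin a → Fin b → ℝ => E k l) p (gaussMatrix a b) :=
  (memLp_id_gaussianReal' p hp).comp_measurePreserving (gm_entry_mp k l)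

lemma gm_entry_integral {a b : ℕ} (k : Fin a) (l : Fin b) :
    ∫ E : Fin a → Fin b → ℝ, E k l ∂(gaussMatrix a b) = 0 := by
  have h := (gm_entry_mp k l)
  have h2 := integral_map (μ := gaussMatrix a b) (φ := fun E : Fin a → Fin b → ℝ => E k l)
    h.measurable.aemeasurable (f := fun x : ℝ => x) (by fun_prop)
  rw [h.map_eq, integral_id_gaussianReal] at h2
  exact h2.symm

lemma gm_lin_memLp {a b : ℕ} (c : Fin a → Fin b → ℝ) (p : ENNReal) (hp : p ≠ ⊤) :
    MemLp (fun E : Fin a → Fin b → ℝ => ∑ k, ∑ l, c k l * E k l) p (gaussMatrix a b) :=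
  memLp_finsetSum _ fun k _ => memLp_finsetSum _ fun l _ =>
    (gm_entry_memLp k l p hp).const_mul _

lemma gm_lin_var {a b : ℕ} (c : Fin a → Fin b → ℝ) :
    Var[fun E : Fin a → Fin b → ℝ => ∑ k, ∑ l, c k l * E k l; gaussMatrix a b]
      = ∑ k, ∑ l, c k l ^ 2 := by
  have hrow : ∀ k l, MemLp (fun x : ℝ => c k l * x) 2 (gaussianReal 0 1) := fun k l =>
    (memLp_id_gaussianReal' 2 (by simp)).const_mul _
  have h1 := variance_sum_pi (μ := fun _ : Fin a => Measure.pi fun _ : Fin b => gaussianReal 0 1)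
    (X := fun k (v : Fin b → ℝ) => ∑ l, c k l * v l) (fun k => memLp_finsetSum _ fun l _ =>
      (hrow k l).comp_measurePreserving
        (measurePreserving_eval (fun _ : Fin b => gaussianReal 0 1) l))
  have e1 : (∑ k : Fin a, fun E : Fin a → Fin b → ℝ => ∑ l, c k l * E k l)
      = fun E : Fin a → Fin b → ℝ => ∑ k, ∑ l, c k l * E k l := by
    ext E; simp
  rw [e1] at h1
  unfold gaussMatrix
  rw [h1]
  refine Finset.sum_congr rfl fun k _ => ?_
  have h2 := variance_sum_pi (μ := fun _ : Fin b => gaussianReal 0 1)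
    (X := fun l (x : ℝ) => c k l * x) (hrow k)
  have e2 : (∑ l : Fin b, fun v : Fin b → ℝ => c k l * v l)
      = fun v : Fin b → ℝ => ∑ l, c k l * v l := by
    ext E; simp
  rw [e2] at h2
  rw [h2]
  refine Finset.sum_congr rfl fun l _ => ?_
  rw [variance_const_mul]
  simp

lemma gm_lin_sq {a b : ℕ} (c : Fin a → Fin b → ℝ) (t : ℝ) :
    ∫ E : Fin a → Fin b → ℝ, (t + ∑ k, ∑ l, c k l * E k l) ^ 2 ∂(gaussMatrix a b)
      = t ^ 2 + ∑ k, ∑ l, c k l ^ 2 := by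
  have hm := gm_lin_memLp c 2 (by simp)
  have hi : Integrable (fun E : Fin a → Fin b → ℝ => ∑ k, ∑ l, c k l * E k l) (gaussMatrix a b) :=
    hm.integrable (by norm_num)
  have h0 : ∫ E : Fin a → Fin b → ℝ, ∑ k, ∑ l, c k l * E k l ∂(gaussMatrix a b) = 0 := by
    have hi2 : ∀ k l, Integrable (fun E : Fin a → Fin b → ℝ => c k l * E k l)
      (gaussMatrix a b) := fun k l =>
        ((gm_entry_memLp k l 1 (by simp)).integrable le_rfl).const_mul _
    rw [integral_finsetSum _ fun k _ => integrable_finsetSum _ fun l _ => hi2 k l]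
    refine Finset.sum_eq_zero fun k _ => ?_
    rw [integral_finsetSum _ fun l _ => hi2 k l]
    refine Finset.sum_eq_zero fun l _ => ?_
    rw [integral_const_mul, gm_entry_integral, mul_zero]
  have hv := variance_eq_sub hm
  rw [gm_lin_var, h0] at hv
  have e : ∀ E : Fin a → Fin b → ℝ, (t + ∑ k, ∑ l, c k l * E k l) ^ 2
      = (t ^ 2 + (2 * t) * ∑ k, ∑ l, c k l * E k l) + (∑ k, ∑ l, c k l * E k l) ^ 2 := by
    intro E; ring
  simp_rw [e]
  have hi1 : Integrable (fun E : Fin a → Fin b → ℝ => t ^ 2 + (2 * t) * ∑ k, ∑ l, c k l * E k l)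
      (gaussMatrix a b) := (integrable_const _).add (hi.const_mul _)
  rw [integral_add hi1 hm.integrable_sq, integral_add (integrable_const _) (hi.const_mul _),
    integral_const_mul, h0, hv]
  simp

lemma gm_affine_entry {a b m q : ℕ} (A : Matrix (Fin m) (Fin q) ℝ)
    (B : Matrix (Fin m) (Fin a) ℝ) (C : Matrix (Fin b) (Fin q) ℝ) (E : Fin a → Fin b → ℝ)
    (i : Fin m) (j : Fin q) :
    (A + B * Matrix.of E * C) i j = A i j + ∑ k, ∑ l, (B i k * C l j) * E k l := by
  simp only [Matrix.add_apply, Matrix.mul_apply, Matrix.of_apply, Finset.sum_mul]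
  rw [Finset.sum_comm]
  congr 1
  refine Finset.sum_congr rfl fun k _ => Finset.sum_congr rfl fun l _ => ?_
  ring

lemma gm_affine_integrable_entry {a b m q : ℕ} (A : Matrix (Fin m) (Fin q) ℝ)
    (B : Matrix (Fin m) (Fin a) ℝ) (C : Matrix (Fin b) (Fin q) ℝ) (i : Fin m) (j : Fin q) :
    Integrable (fun E : Fin a → Fin b → ℝ => ((A + B * Matrix.of E * C) i j) ^ 2)
      (gaussMatrix a b) := by
  simp_rw [gm_affine_entry]
  exact ((memLp_const (A i j)).add
    (gm_lin_memLp (fun k l => B i k * C l j) 2 (by simp))).integrable_sq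

lemma gm_affine_integrable {a b m q : ℕ} (A : Matrix (Fin m) (Fin q) ℝ)
    (B : Matrix (Fin m) (Fin a) ℝ) (C : Matrix (Fin b) (Fin q) ℝ) :
    Integrable (fun E : Fin a → Fin b → ℝ => frobSq (A + B * Matrix.of E * C))
      (gaussMatrix a b) :=
  integrable_finsetSum _ fun i _ => integrable_finsetSum _ fun j _ =>
    gm_affine_integrable_entry A B C i j

lemma gm_affine_integral {a b m q : ℕ} (A : Matrix (Fin m) (Fin q) ℝ)
    (B : Matrix (Fin m) (Fin a) ℝ) (C : Matrix (Fin b) (Fin q) ℝ) :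
    ∫ E : Fin a → Fin b → ℝ, frobSq (A + B * Matrix.of E * C) ∂(gaussMatrix a b)
      = frobSq A + frobSq B * frobSq C := by
  unfold frobSq
  rw [integral_finsetSum _ fun i _ => integrable_finsetSum _ fun j _ =>
    gm_affine_integrable_entry A B C i j]
  simp_rw [integral_finsetSum _ fun j _ => gm_affine_integrable_entry A B C _ j]
  simp_rw [gm_affine_entry, gm_lin_sq, Finset.sum_add_distrib]
  congr 1
  rw [Finset.sum_mul]
  refine Finset.sum_congr rfl fun i _ => ?_
  rw [Finset.sum_comm, Finset.sum_mul]
  refine Finset.sum_congr rfl fun k _ => ?_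
  rw [Finset.sum_comm, Finset.mul_sum]
  refine Finset.sum_congr rfl fun l _ => ?_
  rw [Finset.mul_sum]
  refine Finset.sum_congr rfl fun j _ => ?_
  ring

lemma frobSq_smul {a b : ℕ} (s : ℝ) (A : Matrix (Fin a) (Fin b) ℝ) :
    frobSq (s • A) = s ^ 2 * frobSq A := by
  simp [frobSq, mul_pow, Finset.mul_sum]

lemma frobSq_one {a : ℕ} : frobSq (1 : Matrix (Fin a) (Fin a) ℝ) = a := by
  simp [frobSq, Matrix.one_apply]

lemma frobSq_transpose {a b : ℕ} (A : Matrix (Fin a) (Fin b) ℝ) :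
    frobSq Aᵀ = frobSq A := by
  simp only [frobSq, Matrix.transpose_apply]
  exact Finset.sum_comm

lemma holder442 : ENNReal.HolderTriple 4 4 2 := ⟨by
    rw [← two_mul, show (4 : ENNReal) = 2 * 2 by norm_num,
      ENNReal.mul_inv (by simp) (by simp), ← mul_assoc,
      ENNReal.mul_inv_cancel (by simp) (by simp), one_mul]⟩

lemma prod_snd_memLp {d₀ d₁ d₂ : ℕ} (u σ : ℝ) (i : Fin d₂) (k : Fin d₁)
    (p : ENNReal) (hp : p ≠ ⊤) :
    MemLp (fun E : (Fin d₁ → Fin d₀ → ℝ) × (Fin d₂ → Fin d₁ → ℝ) => u + σ * E.2 i k) p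
      ((gaussMatrix d₁ d₀).prod (gaussMatrix d₂ d₁)) := by
  have m : MeasurePreserving Prod.snd
      ((gaussMatrix d₁ d₀).prod (gaussMatrix d₂ d₁)) (gaussMatrix d₂ d₁) := measurePreserving_snd
  have h := (gm_entry_memLp i k p hp).comp_measurePreserving m
  exact (memLp_const u).add (h.const_mul σ)

lemma prod_fst_memLp {d₀ d₁ d₂ : ℕ} (u σ : ℝ) (k : Fin d₁) (l : Fin d₀)
    (p : ENNReal) (hp : p ≠ ⊤) :
    MemLp (fun E : (Fin d₁ → Fin d₀ → ℝ) × (Fin d₂ → Fin d₁ → ℝ) => u + σ * E.1 k l) p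
      ((gaussMatrix d₁ d₀).prod (gaussMatrix d₂ d₁)) := by
  have m : MeasurePreserving Prod.fst
      ((gaussMatrix d₁ d₀).prod (gaussMatrix d₂ d₁)) (gaussMatrix d₁ d₀) := measurePreserving_fst
  have h := (gm_entry_memLp k l p hp).comp_measurePreserving m
  exact (memLp_const u).add (h.const_mul σ)

lemma mul_memLp_aux {Ω : Type*} [MeasurableSpace Ω] {μ : Measure Ω} {p q r : ENNReal}
    (h : ENNReal.HolderTriple p q r) {f g : Ω → ℝ} (hf : MemLp f p μ) (hg : MemLp g q μ) :
    MemLp (fun x => f x * g x) r μ := hg.mul hf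

lemma four_ne_top_aux : (4 : ENNReal) ≠ ⊤ := by simp

lemma prod_factor_memLp {d₀ d₁ d₂ : ℕ} (u v σ : ℝ) (i : Fin d₂) (k : Fin d₁) (l : Fin d₀) :
    MemLp (fun E : (Fin d₁ → Fin d₀ → ℝ) × (Fin d₂ → Fin d₁ → ℝ) =>
      (u + σ * E.2 i k) * (v + σ * E.1 k l)) 2
      ((gaussMatrix d₁ d₀).prod (gaussMatrix d₂ d₁)) :=
  mul_memLp_aux holder442 (prod_snd_memLp u σ i k 4 four_ne_top_aux)
    (prod_fst_memLp v σ k l 4 four_ne_top_aux)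

lemma prod_entry_memLp {n d₀ d₁ d₂ : ℕ} (X : Matrix (Fin n) (Fin d₀) ℝ)
    (W₁ : Matrix (Fin d₁) (Fin d₀) ℝ) (W₂ : Matrix (Fin d₂) (Fin d₁) ℝ) (σ y : ℝ)
    (i : Fin d₂) (j : Fin n) :
    MemLp (fun E : (Fin d₁ → Fin d₀ → ℝ) × (Fin d₂ → Fin d₁ → ℝ) =>
      y - ∑ l, (∑ k, (W₂ i k + σ * E.2 i k) * (W₁ k l + σ * E.1 k l)) * X j l) 2
      ((gaussMatrix d₁ d₀).prod (gaussMatrix d₂ d₁)) := by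
  have h1 : ∀ l, MemLp (fun E : (Fin d₁ → Fin d₀ → ℝ) × (Fin d₂ → Fin d₁ → ℝ) =>
      (∑ k, (W₂ i k + σ * E.2 i k) * (W₁ k l + σ * E.1 k l)) * X j l) 2
      ((gaussMatrix d₁ d₀).prod (gaussMatrix d₂ d₁)) := fun l =>
    (memLp_finsetSum _ fun k _ => prod_factor_memLp _ _ σ i k l).mul_const _
  exact (memLp_const y).sub (memLp_finsetSum _ fun l _ => h1 l)

lemma prod_integrable {n d₀ d₁ d₂ : ℕ} (X : Matrix (Fin n) (Fin d₀) ℝ)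
    (Y : Matrix (Fin n) (Fin d₂) ℝ)
    (W₁ : Matrix (Fin d₁) (Fin d₀) ℝ) (W₂ : Matrix (Fin d₂) (Fin d₁) ℝ) (σ : ℝ) :
    Integrable (fun E : (Fin d₁ → Fin d₀ → ℝ) × (Fin d₂ → Fin d₁ → ℝ) =>
      frobSq (Yᵀ - (W₂ + σ • Matrix.of E.2) * (W₁ + σ • Matrix.of E.1) * Xᵀ))
      ((gaussMatrix d₁ d₀).prod (gaussMatrix d₂ d₁)) := by
  simp only [frobSq, Matrix.sub_apply, Matrix.mul_apply, Matrix.transpose_apply, Matrix.add_apply,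
    Matrix.smul_apply, Matrix.of_apply, smul_eq_mul]
  exact integrable_finsetSum _ fun i _ => integrable_finsetSum _ fun j _ =>
    (prod_entry_memLp X W₁ W₂ σ (Y j i) i j).integrable_sq

lemma full_integral {n d₀ d₁ d₂ : ℕ} (X : Matrix (Fin n) (Fin d₀) ℝ)
    (Y : Matrix (Fin n) (Fin d₂) ℝ)
    (W₁ : Matrix (Fin d₁) (Fin d₀) ℝ) (W₂ : Matrix (Fin d₂) (Fin d₁) ℝ) (σ : ℝ) :
    ∫ E, frobSq (Yᵀ - (W₂ + σ • Matrix.of E.2) * (W₁ + σ • Matrix.of E.1) * Xᵀ)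
      ∂((gaussMatrix d₁ d₀).prod (gaussMatrix d₂ d₁))
    = frobSq (Yᵀ - W₂ * W₁ * Xᵀ) + σ ^ 2 * (frobSq W₂ * frobSq X + d₂ * frobSq (W₁ * Xᵀ))
      + σ ^ 4 * (d₁ * d₂) * frobSq X := by
  rw [integral_prod _ (prod_integrable X Y W₁ W₂ σ)]
  have h1 : ∀ E₁ : Fin d₁ → Fin d₀ → ℝ,
      ∫ E₂, frobSq (Yᵀ - (W₂ + σ • Matrix.of E₂) * (W₁ + σ • Matrix.of E₁) * Xᵀ)
        ∂(gaussMatrix d₂ d₁)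
      = frobSq ((Yᵀ - W₂ * W₁ * Xᵀ) + ((-σ) • W₂) * Matrix.of E₁ * Xᵀ)
        + (σ ^ 2 * d₂) * frobSq (W₁ * Xᵀ + (σ • (1 : Matrix (Fin d₁) (Fin d₁) ℝ)) *
            Matrix.of E₁ * Xᵀ) := by
    intro E₁
    have e : ∀ E₂ : Fin d₂ → Fin d₁ → ℝ,
        Yᵀ - (W₂ + σ • Matrix.of E₂) * (W₁ + σ • Matrix.of E₁) * Xᵀ
        = ((Yᵀ - W₂ * W₁ * Xᵀ) + ((-σ) • W₂) * Matrix.of E₁ * Xᵀ)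
          + ((-σ) • (1 : Matrix (Fin d₂) (Fin d₂) ℝ)) * Matrix.of E₂ *
            (W₁ * Xᵀ + (σ • (1 : Matrix (Fin d₁) (Fin d₁) ℝ)) * Matrix.of E₁ * Xᵀ) := by
      intro E₂
      simp only [Matrix.add_mul, Matrix.mul_add, Matrix.smul_mul, Matrix.mul_smul, Matrix.one_mul,
        Matrix.mul_assoc, neg_smul, smul_add, smul_neg, Matrix.neg_mul]
      abel
    simp_rw [e]
    rw [gm_affine_integral, frobSq_smul, frobSq_one]
    ring
  simp_rw [h1]
  rw [integral_add (gm_affine_integrable _ _ _) ((gm_affine_integrable _ _ _).const_mul _),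
    integral_const_mul, gm_affine_integral, gm_affine_integral, frobSq_smul, frobSq_smul,
    frobSq_one, frobSq_transpose]
  ring

/-- The fully perturbed risk of a two-layer linear network satisfies exactly
`E[R(W₁+σE₁, W₂+σE₂)] = R(W₁,W₂) + (σ²/2n)[‖W₂‖_F²‖X‖_F² + d₂‖W₁Xᵀ‖_F²] + (σ⁴/2n)d₁d₂‖X‖_F²`;
in particular the extra variance term `(σ⁴/2n)d₁d₂‖X‖_F²` diverges as the width `d₁ → ∞`. -/
theorem fully_perturbed_risk_exact
    (n d₀ d₁ d₂ : ℕ) (hn : 0 < n)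
    (X : Matrix (Fin n) (Fin d₀) ℝ) (Y : Matrix (Fin n) (Fin d₂) ℝ)
    (W₁ : Matrix (Fin d₁) (Fin d₀) ℝ) (W₂ : Matrix (Fin d₂) (Fin d₁) ℝ)
    (σ : ℝ) (hσ : 0 < σ) :
    (∫ E, risk n d₀ d₁ d₂ X Y (W₁ + σ • Matrix.of E.1) (W₂ + σ • Matrix.of E.2)
        ∂((gaussMatrix d₁ d₀).prod (gaussMatrix d₂ d₁))
      = risk n d₀ d₁ d₂ X Y W₁ W₂
        + σ ^ 2 / (2 * (n : ℝ)) * (frobSq W₂ * frobSq X + (d₂ : ℝ) * frobSq (W₁ * Xᵀ))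
        + σ ^ 4 / (2 * (n : ℝ)) * ((d₁ : ℝ) * (d₂ : ℝ)) * frobSq X) ∧
    (0 < d₂ → 0 < frobSq X →
      Tendsto (fun k : ℕ => σ ^ 4 / (2 * (n : ℝ)) * ((k : ℝ) * (d₂ : ℝ)) * frobSq X)
        atTop atTop) := by
  refine ⟨?_, fun hd hX => ?_⟩
  · unfold risk
    rw [integral_const_mul, full_integral]
    ring
  · have hc : 0 < σ ^ 4 / (2 * (n : ℝ)) * (d₂ : ℝ) * frobSq X := by
      have : (0 : ℝ) < n := by exact_mod_cast hn
      have : (0 : ℝ) < d₂ := by exact_mod_cast hd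
      positivity
    have h := (tendsto_natCast_atTop_atTop (R := ℝ)).const_mul_atTop hc
    refine h.congr fun k => ?_
    ring
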